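/- For every convex pentagon P in the plane there exists a convex quadrilateral Q with P ⊆ Q and |Q| ≤ (3/√5)·|P|. -/

import Mathlib

open MeasureTheory

/-- A convex `n`-gon in the plane: the convex hull of a finite set of at most `n` points,
having nonempty interior. -/
def IsConvexPolygon (n : ℕ) (Q : Set (ℝ × ℝ)) : Prop :=
  ∃ S : Finset (ℝ × ℝ), S.card ≤ n ∧ Q = convexHull ℝ (S : Set (ℝ × ℝ)) ∧
    (interior Q).Nonempty

/-- Twice the signed area of the triangle `A B C`. -/
def cross (A B C : ℝ × ℝ) : ℝ :=
  (B.1 - A.1) * (C.2 - A.2) - (B.2 - A.2) * (C.1 - A.1)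

lemma cross_rotate (A B C : ℝ × ℝ) : cross B C A = cross A B C := by
  simp only [cross]; ring

lemma cross_swap (A B C : ℝ × ℝ) : cross B A C = -cross A B C := by
  simp only [cross]; ring

lemma cross_swap_right (A B C : ℝ × ℝ) : cross A C B = -cross A B C := by
  simp only [cross]; ring

lemma le_cross_of_mem_convexHull {s : Set (ℝ × ℝ)} {A B z : ℝ × ℝ} {k : ℝ}
    (h : ∀ w ∈ s, k ≤ cross A B w) (hz : z ∈ convexHull ℝ s) : k ≤ cross A B z := by
  have hc : Convex ℝ {w | k ≤ cross A B w} := by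
    intro w hw w' hw' a b ha hb hab
    simp only [Set.mem_ofPred_eq] at *
    have e : cross A B (a • w + b • w') = a * cross A B w + b * cross A B w' := by
      obtain rfl : b = 1 - a := by linarith
      simp only [cross, Prod.fst_add, Prod.snd_add, Prod.smul_fst, Prod.smul_snd, smul_eq_mul]
      ring
    rw [e]
    have e' : k = a * k + b * k := by rw [← add_mul, hab, one_mul]
    rw [e']
    gcongr
  exact convexHull_min (t := {w | k ≤ cross A B w}) h hc hz

lemma mem_triangle_of_cross_nonneg {A B C z : ℝ × ℝ} (h : 0 < cross A B C)
    (hAB : 0 ≤ cross A B z) (hBC : 0 ≤ cross B C z) (hCA : 0 ≤ cross C A z) :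
    z ∈ convexHull ℝ {A, B, C} := by
  have hz : z = (cross B C z / cross A B C) • A + (cross C A z / cross A B C) • B
      + (cross A B z / cross A B C) • C := by
    ext <;> simp only [Prod.fst_add, Prod.snd_add, Prod.smul_fst, Prod.smul_snd, smul_eq_mul] <;>
    · field_simp
      simp only [cross]
      ring
  have hsum : cross B C z / cross A B C + cross C A z / cross A B C
      + cross A B z / cross A B C = 1 := by
    field_simp
    simp only [cross]
    ring
  have key := (convex_convexHull ℝ {A, B, C}).sum_mem (t := Finset.univ)
    (w := ![cross B C z / cross A B C, cross C A z / cross A B C, cross A B z / cross A B C])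
    (z := ![A, B, C])
    (by intro i _; fin_cases i <;> simp <;> positivity)
    (by simpa [Fin.sum_univ_three] using hsum)
    (by intro i _; apply subset_convexHull; fin_cases i <;> simp)
  rw [hz]
  simpa [Fin.sum_univ_three] using key

lemma volume_triangle {A B C : ℝ × ℝ} (h : 0 ≤ cross A B C) :
    volume (convexHull ℝ {A, B, C}) =
      ENNReal.ofReal (cross A B C) *
        volume (convexHull ℝ {((0 : ℝ), (0 : ℝ)), ((1 : ℝ), (0 : ℝ)), ((0 : ℝ), (1 : ℝ))}) := by
  set M : Matrix (Fin 2) (Fin 2) ℝ := !![B.1 - A.1, C.1 - A.1; B.2 - A.2, C.2 - A.2]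
  set f : ℝ × ℝ →ₗ[ℝ] ℝ × ℝ :=
    Matrix.toLin (Module.Basis.finTwoProd ℝ) (Module.Basis.finTwoProd ℝ) M
  have hdet : LinearMap.det f = cross A B C := by
    simp only [f, LinearMap.det_toLin, M, Matrix.det_fin_two_of, cross]
    ring
  have hf (x : ℝ × ℝ) : f x = ((B.1 - A.1) * x.1 + (C.1 - A.1) * x.2,
      (B.2 - A.2) * x.1 + (C.2 - A.2) * x.2) := Matrix.toLin_finTwoProd_apply _ _ _ _ _
  have himg : convexHull ℝ {A, B, C} = (fun x => A + x) ''
      (f '' convexHull ℝ {((0 : ℝ), (0 : ℝ)), ((1 : ℝ), (0 : ℝ)), ((0 : ℝ), (1 : ℝ))}) := by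
    rw [LinearMap.image_convexHull]
    refine Eq.trans ?_ ((AffineEquiv.constVAdd ℝ (ℝ × ℝ) A).toAffineMap.image_convexHull
      (f '' {((0 : ℝ), (0 : ℝ)), ((1 : ℝ), (0 : ℝ)), ((0 : ℝ), (1 : ℝ))})).symm
    simp [Set.image_insert_eq, hf, Prod.add_def]
  rw [himg, Set.image_add_left, measure_preimage_add, Measure.addHaar_image_linearMap, hdet,
    abs_of_nonneg h]

lemma volume_line {A B : ℝ × ℝ} (h : A ≠ B) : volume {z | cross A B z = 0} = 0 := by
  set f : ℝ × ℝ →ₗ[ℝ] ℝ :=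
    (B.1 - A.1) • LinearMap.snd ℝ ℝ ℝ - (B.2 - A.2) • LinearMap.fst ℝ ℝ ℝ
  have hf (z : ℝ × ℝ) : f z = (B.1 - A.1) * z.2 - (B.2 - A.2) * z.1 := rfl
  have hker : f.ker ≠ ⊤ := by
    intro h0
    rw [LinearMap.ker_eq_top] at h0
    have h1 := hf (1, 0)
    have h2 := hf (0, 1)
    rw [h0] at h1 h2
    simp at h1 h2
    exact h (Prod.ext (by linarith) (by linarith))
  have hline : {z | cross A B z = 0} = (fun z => -A + z) ⁻¹' (f.ker : Set (ℝ × ℝ)) := by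
    ext z
    simp only [Set.mem_ofPred_eq, Set.mem_preimage, SetLike.mem_coe, LinearMap.mem_ker, hf, cross,
      Prod.fst_add, Prod.snd_add, Prod.fst_neg, Prod.snd_neg]
    ring_nf
  rw [hline, measure_preimage_add]
  exact Measure.addHaar_submodule _ _ hker

/-- The points `A, B, C, D, E` are the vertices, in counterclockwise order, of a strictly convex
pentagon. -/
structure IsCcwPentagon (A B C D E : ℝ × ℝ) : Prop where
  abc : 0 < cross A B C
  abd : 0 < cross A B D
  abe : 0 < cross A B E
  acd : 0 < cross A C D
  ace : 0 < cross A C E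
  ade : 0 < cross A D E
  bcd : 0 < cross B C D
  bce : 0 < cross B C E
  bde : 0 < cross B D E
  cde : 0 < cross C D E

lemma IsCcwPentagon.rotate {A B C D E : ℝ × ℝ} (h : IsCcwPentagon A B C D E) :
    IsCcwPentagon B C D E A where
  abc := h.bcd
  abd := h.bce
  abe := by rw [cross_rotate]; exact h.abc
  acd := h.bde
  ace := by rw [cross_rotate]; exact h.abd
  ade := by rw [cross_rotate]; exact h.abe
  bcd := h.cde
  bce := by rw [cross_rotate]; exact h.acd
  bde := by rw [cross_rotate]; exact h.ace
  cde := by rw [cross_rotate]; exact h.ade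

lemma mem_segment_of_cross_eq_zero {A B C : ℝ × ℝ} {a b : ℝ} (h : cross A B C = 0)
    (hB : 0 < a * (B.1 - A.1) + b * (B.2 - A.2))
    (hBC : a * (B.1 - A.1) + b * (B.2 - A.2) ≤ a * (C.1 - A.1) + b * (C.2 - A.2)) :
    B ∈ segment ℝ A C := by
  have hC := hB.trans_le hBC
  set r := (a * (B.1 - A.1) + b * (B.2 - A.2)) / (a * (C.1 - A.1) + b * (C.2 - A.2)) with hr
  refine ⟨1 - r, r, sub_nonneg.2 ((div_le_one hC).2 hBC), by positivity, by ring, ?_⟩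
  simp only [cross] at h
  have e1 : r * (C.1 - A.1) = B.1 - A.1 := by
    rw [hr]
    field_simp
    linear_combination -b * h
  have e2 : r * (C.2 - A.2) = B.2 - A.2 := by
    rw [hr]
    field_simp
    linear_combination a * h
  ext <;> simp only [Prod.fst_add, Prod.snd_add, Prod.smul_fst, Prod.smul_snd, smul_eq_mul]
  · linear_combination e1
  · linear_combination e2

lemma exists_isCcwPentagon {S : Finset (ℝ × ℝ)} (hcard : S.card = 5)
    (hS : ∀ p ∈ S, p ∉ convexHull ℝ (S.erase p : Set (ℝ × ℝ))) :
    ∃ A B C D E, (S : Set (ℝ × ℝ)) = {A, B, C, D, E} ∧ IsCcwPentagon A B C D E := by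
  obtain ⟨A, hA⟩ : S.Nonempty := Finset.card_pos.1 (by omega)
  obtain ⟨f, u, hfA, hfu⟩ := geometric_hahn_banach_point_closed
    (convex_convexHull ℝ _) ((S.erase A).finite_toSet.isClosed_convexHull ℝ) (hS A hA)
  set a := f (1, 0)
  set b := f (0, 1)
  have hf (z : ℝ × ℝ) : f z = a * z.1 + b * z.2 := by
    have : z = z.1 • ((1 : ℝ), (0 : ℝ)) + z.2 • ((0 : ℝ), (1 : ℝ)) := by ext <;> simp
    conv_lhs => rw [this]
    rw [map_add, map_smul, map_smul, smul_eq_mul, smul_eq_mul]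
    ring
  have hpos {w : ℝ × ℝ} (hw : w ∈ S.erase A) : 0 < a * (w.1 - A.1) + b * (w.2 - A.2) := by
    have := hfA.trans (hfu w (subset_convexHull ℝ _ hw))
    rw [hf, hf] at this
    linarith
  let e := (S.erase A).equivFinOfCardEq (n := 4) (by rw [Finset.card_erase_of_mem hA, hcard])
  let key (w : ℝ × ℝ) : ℝ :=
    (a * (w.2 - A.2) - b * (w.1 - A.1)) / (a * (w.1 - A.1) + b * (w.2 - A.2))
  let σ := Tuple.sort fun i => key (e.symm i)
  let q (i : Fin 4) : ℝ × ℝ := e.symm (σ i)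
  have hq (i : Fin 4) : q i ∈ S.erase A := (e.symm (σ i)).2
  have hqA (i : Fin 4) : q i ≠ A := Finset.ne_of_mem_erase (hq i)
  have hqS (i : Fin 4) : q i ∈ S := Finset.mem_of_mem_erase (hq i)
  have hinj : Function.Injective q :=
    Subtype.val_injective.comp (e.symm.injective.comp σ.injective)
  have hmono : Monotone fun i => key (q i) := Tuple.monotone_sort fun i => key (e.symm i)
  have hfan {i j : Fin 4} (hij : i < j) : 0 < cross A (q i) (q j) := by
    have hi := hpos (hq i)
    have hj := hpos (hq j)
    have hle := hmono hij.le
    simp only [key] at hle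
    rw [div_le_div_iff₀ hi hj] at hle
    have hab : 0 < a ^ 2 + b ^ 2 := by
      by_contra hab
      have ha : a = 0 := by nlinarith [sq_nonneg a, sq_nonneg b]
      have hb : b = 0 := by nlinarith [sq_nonneg a, sq_nonneg b]
      simp [ha, hb] at hi
    have hnonneg : 0 ≤ cross A (q i) (q j) := by
      refine nonneg_of_mul_nonneg_right (a := a ^ 2 + b ^ 2) ?_ hab
      simp only [cross]
      linarith
    refine hnonneg.lt_of_ne' fun h0 => ?_
    rcases le_total (a * ((q i).1 - A.1) + b * ((q i).2 - A.2))
      (a * ((q j).1 - A.1) + b * ((q j).2 - A.2)) with h | h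
    · refine hS (q i) (hqS i) (segment_subset_convexHull ?_ ?_
        (mem_segment_of_cross_eq_zero h0 hi h))
      · simp [hA, (hqA i).symm]
      · simp [hqS j, hinj.ne hij.ne']
    · have h0' : cross A (q j) (q i) = 0 := by
        rw [cross_swap_right, h0, neg_zero]
      refine hS (q j) (hqS j) (segment_subset_convexHull ?_ ?_
        (mem_segment_of_cross_eq_zero h0' hj h))
      · simp [hA, (hqA j).symm]
      · simp [hqS i, hinj.ne hij.ne]
  have htri {i j k : Fin 4} (hij : i < j) (hjk : j < k) : 0 < cross (q i) (q j) (q k) := by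
    by_contra! h
    refine hS (q j) (hqS j) (convexHull_mono ?_ (mem_triangle_of_cross_nonneg
      (hfan (hij.trans hjk)) (hfan hij).le (?_ : 0 ≤ cross (q i) (q k) (q j)) ?_))
    · simp [Set.insert_subset_iff, hA, hqS, (hqA j).symm, hinj.ne hij.ne, hinj.ne hjk.ne']
    · rw [cross_swap_right]
      linarith
    · rw [← cross_rotate]
      exact (hfan hjk).le
  refine ⟨A, q 0, q 1, q 2, q 3, ?_, ?_⟩
  · have hSq : S = insert A (Finset.univ.image q) := by
      refine (Finset.eq_of_subset_of_card_le ?_ ?_).symm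
      · intro w hw
        simp only [Finset.mem_insert, Finset.mem_image, Finset.mem_univ, true_and] at hw
        rcases hw with rfl | ⟨i, rfl⟩
        exacts [hA, hqS i]
      · rw [Finset.card_insert_of_notMem (by simpa using hqA),
          Finset.card_image_of_injective _ hinj, hcard]
        simp
    rw [hSq]
    ext w
    simp [Fin.exists_fin_succ, eq_comm]
  · constructor <;> first | exact hfan (by decide) | exact htri (by decide) (by decide)

lemma volume_pentagon_ge {A B C D E : ℝ × ℝ} (h : IsCcwPentagon A B C D E) :
    ENNReal.ofReal (cross A B C + cross A C D + cross A D E) *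
        volume (convexHull ℝ {((0 : ℝ), (0 : ℝ)), ((1 : ℝ), (0 : ℝ)), ((0 : ℝ), (1 : ℝ))}) ≤
      volume (convexHull ℝ {A, B, C, D, E}) := by
  have hm (X Y Z : ℝ × ℝ) : NullMeasurableSet (convexHull ℝ {X, Y, Z}) volume :=
    ((Set.toFinite {X, Y, Z}).isClosed_convexHull ℝ).measurableSet.nullMeasurableSet
  have hne {X Y Z : ℝ × ℝ} (h : 0 < cross X Y Z) : X ≠ Y := by
    rintro rfl
    simp [cross] at h
  have hz (X Y : ℝ × ℝ) : cross X Y X = 0 ∧ cross X Y Y = 0 := by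
    constructor <;> simp only [cross] <;> ring
  have hside {X Y : ℝ × ℝ} {s t : Set (ℝ × ℝ)} (hXY : X ≠ Y)
      (hs : ∀ w ∈ s, 0 ≤ cross Y X w) (ht : ∀ w ∈ t, 0 ≤ cross X Y w) :
      AEDisjoint volume (convexHull ℝ s) (convexHull ℝ t) := by
    refine measure_mono_null (fun z hzz => ?_) (volume_line hXY)
    have h1 := le_cross_of_mem_convexHull hs hzz.1
    have h2 := le_cross_of_mem_convexHull ht hzz.2
    rw [cross_swap] at h1
    exact le_antisymm (by linarith) h2
  have habc := h.abc
  have habd := h.abd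
  have hacd := h.acd
  have hade := h.ade
  have h1 : AEDisjoint volume (convexHull ℝ {A, B, C}) (convexHull ℝ {A, C, D}) := by
    refine hside (hne hacd) ?_ ?_
    · simp [hz, cross_swap A C, cross_swap_right A B C, habc.le]
    · simp [hz, hacd.le]
  have h2 : AEDisjoint volume (convexHull ℝ {A, B, C} ∪ convexHull ℝ {A, C, D})
      (convexHull ℝ {A, D, E}) := by
    refine AEDisjoint.union_left ?_ ?_
    · refine hside (hne hade) ?_ ?_
      · simp [hz, cross_swap A D, cross_swap_right A B D,
          cross_swap_right A C D, habd.le, hacd.le]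
      · simp [hz, hade.le]
    · refine hside (hne hade) ?_ ?_
      · simp [hz, cross_swap A D, cross_swap_right A C D, hacd.le]
      · simp [hz, hade.le]
  rw [ENNReal.ofReal_add (by positivity) hade.le, ENNReal.ofReal_add habc.le hacd.le, add_mul,
    add_mul, ← volume_triangle habc.le, ← volume_triangle hacd.le, ← volume_triangle hade.le,
    ← measure_union₀ (hm _ _ _) h1, ← measure_union₀ (hm _ _ _) h2]
  refine measure_mono (Set.union_subset (Set.union_subset ?_ ?_) ?_) <;>
    exact convexHull_mono (by simp [Set.insert_subset_iff])

lemma mem_pentagon_of_cross_nonneg {A B C D E z : ℝ × ℝ} (h : IsCcwPentagon A B C D E)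
    (hAB : 0 ≤ cross A B z) (hBC : 0 ≤ cross B C z) (hCD : 0 ≤ cross C D z)
    (hDE : 0 ≤ cross D E z) (hEA : 0 ≤ cross E A z) :
    z ∈ convexHull ℝ {A, B, C, D, E} := by
  rcases le_total 0 (cross C A z) with h1 | h1
  · exact convexHull_mono (by simp [Set.insert_subset_iff])
      (mem_triangle_of_cross_nonneg h.abc hAB hBC h1)
  rw [cross_swap] at h1
  rcases le_total 0 (cross D A z) with h2 | h2
  · exact convexHull_mono (by simp [Set.insert_subset_iff])
      (mem_triangle_of_cross_nonneg h.acd (by linarith) hCD h2)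
  rw [cross_swap] at h2
  exact convexHull_mono (by simp [Set.insert_subset_iff])
    (mem_triangle_of_cross_nonneg h.ade (by linarith) hDE hEA)

lemma area_ratio_bound {t p q x y m : ℝ} (ht : 0 < t) (hp : t ≤ p) (hq : t ≤ q)
    (hx : 0 < x) (hy : 0 < y) (hxm : x + t ≤ m) (hym : y + t ≤ m)
    (h : x * y = p * x + q * y - t * (x + y - m)) :
    t * (p / y) + t * (q / x) ≤ (3 / √5 - 1) * (m + t) := by
  have hm : 0 < m := by linarith
  have hs : √5 ^ 2 = 5 := Real.sq_sqrt (by norm_num)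
  have hs0 : 0 < √5 := by positivity
  have hs2 : 2 < √5 := by nlinarith
  have hs3 : √5 < 2.24 := by nlinarith
  have hxy : t * m ≤ x * y := by nlinarith
  have hmt : t * m ≤ (m - t) ^ 2 := by nlinarith
  have hm2 : (3 + √5) / 2 * t ≤ m := by
    have hpos : 0 < m - (3 - √5) / 2 * t := by nlinarith
    refine sub_nonneg.1 (nonneg_of_mul_nonneg_left (b := m - (3 - √5) / 2 * t) ?_ hpos)
    linear_combination hmt + t ^ 2 / 4 * hs
  have hbound : t * (p / y) + t * (q / x) ≤ 2 * t * (m - t) / m := by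
    have e : t * (p / y) + t * (q / x) = t + t ^ 2 * (x + y - m) / (x * y) := by
      field_simp
      linear_combination -h
    have e' : 2 * t * (m - t) / m = t + t * (m - 2 * t) / m := by field_simp; ring
    have h1 : (x + y - m) / (x * y) ≤ (m - 2 * t) / (m - t) ^ 2 := by
      have hmt' : 0 < m - t := by linarith
      have hstep : (x + y - m) / (x * y) ≤ ((m - t) + y - m) / ((m - t) * y) := by
        rw [div_le_div_iff₀ (by positivity) (by positivity)]
        nlinarith [mul_nonneg (mul_nonneg hy.le (by linarith : 0 ≤ m - y))
          (by linarith : 0 ≤ m - t - x)]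
      refine hstep.trans ?_
      rw [div_le_div_iff₀ (by positivity) (by positivity)]
      nlinarith [mul_nonneg (mul_nonneg hmt'.le ht.le) (by linarith : 0 ≤ m - t - y)]
    have h2 : (m - 2 * t) / (m - t) ^ 2 ≤ (m - 2 * t) / (t * m) := by
      apply div_le_div_of_nonneg_left _ (by positivity) hmt
      nlinarith
    rw [e, e', mul_div_assoc]
    calc t + t ^ 2 * ((x + y - m) / (x * y)) ≤ t + t ^ 2 * ((m - 2 * t) / (t * m)) := by
          linarith [mul_le_mul_of_nonneg_left (h1.trans h2) (sq_nonneg t)]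
      _ = _ := by field_simp
  refine hbound.trans ?_
  have e : 3 / √5 = 3 * √5 / 5 := by field_simp; linear_combination -hs
  rw [e, div_le_iff₀ hm]
  have key : (3 * √5 / 5 - 1) * (m + t) * m - 2 * t * (m - t) =
      (m - (3 + √5) / 2 * t) * ((3 * √5 / 5 - 1) * m - (3 - √5) * t) := by
    linear_combination (3 * m * t / 10 + t^2/2) * hs
  have h3 : 0 ≤ (3 * √5 / 5 - 1) * m - (3 - √5) * t := by nlinarith
  nlinarith [mul_nonneg (sub_nonneg.2 hm2) h3]

/-- If `A` is the vertex cutting off the smallest ear, the quadrilateral bounded by the lines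
`BC`, `CD`, `DE` and the parallel to `BE` through `A` is small enough. -/
lemma IsCcwPentagon.exists_quadrilateral_of_min_ear {A B C D E : ℝ × ℝ} (h : IsCcwPentagon A B C D E)
    (hB : cross A B E ≤ cross A B C) (hC : cross A B E ≤ cross B C D)
    (hD : cross A B E ≤ cross C D E) (hE : cross A B E ≤ cross A D E) :
    ∃ X Y : ℝ × ℝ, convexHull ℝ {A, B, C, D, E} ⊆ convexHull ℝ {X, Y, C, D} ∧
      volume (convexHull ℝ {X, Y, C, D}) ≤
        ENNReal.ofReal (3 / √5) * volume (convexHull ℝ {A, B, C, D, E}) := by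
  obtain ⟨habc, habd, habe, hacd, hace, hade, hbcd, hbce, hbde, hcde⟩ := id h
  set s := cross A B E / cross B C E with hs
  set r := cross A B E / cross B D E with hr
  set α := cross A B C / cross B C E with hα
  set β := cross A D E / cross B D E with hβ
  have hs0 : 0 < s := by positivity
  have hr0 : 0 < r := by positivity
  have hα0 : 0 < α := by positivity
  have hβ0 : 0 < β := by positivity
  set X : ℝ × ℝ := B + s • (B - C) with hX
  set Y : ℝ × ℝ := E + r • (E - D) with hY
  have hAX : A = X + α • (E - B) := by
    ext <;> simp only [hX, hs, hα, Prod.fst_add, Prod.snd_add, Prod.smul_fst, Prod.smul_snd,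
      smul_eq_mul, Prod.fst_sub, Prod.snd_sub] <;> field_simp <;> simp only [cross] <;> ring
  have hAY : Y = A + β • (E - B) := by
    ext <;> simp only [hY, hr, hβ, Prod.fst_add, Prod.snd_add, Prod.smul_fst, Prod.smul_snd,
      smul_eq_mul, Prod.fst_sub, Prod.snd_sub] <;> field_simp <;> simp only [cross] <;> ring
  have cross_X (P Q : ℝ × ℝ) : cross P Q X = cross P Q B + s * (cross P Q B - cross P Q C) := by
    simp only [hX, cross, Prod.fst_add, Prod.snd_add, Prod.smul_fst, Prod.smul_snd,
      smul_eq_mul, Prod.fst_sub, Prod.snd_sub]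
    ring
  have cross_Y (P Q : ℝ × ℝ) : cross P Q Y = cross P Q E + r * (cross P Q E - cross P Q D) := by
    simp only [hY, cross, Prod.fst_add, Prod.snd_add, Prod.smul_fst, Prod.smul_snd,
      smul_eq_mul, Prod.fst_sub, Prod.snd_sub]
    ring
  have hB_mem : B ∈ segment ℝ X C := by
    refine ⟨1 / (1 + s), s / (1 + s), by positivity, by positivity, by field_simp, ?_⟩
    rw [hX]
    ext <;> simp only [Prod.fst_add, Prod.snd_add, Prod.smul_fst, Prod.smul_snd,
      smul_eq_mul, Prod.fst_sub, Prod.snd_sub] <;> field_simp <;> ring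
  have hE_mem : E ∈ segment ℝ Y D := by
    refine ⟨1 / (1 + r), r / (1 + r), by positivity, by positivity, by field_simp, ?_⟩
    rw [hY]
    ext <;> simp only [Prod.fst_add, Prod.snd_add, Prod.smul_fst, Prod.smul_snd,
      smul_eq_mul, Prod.fst_sub, Prod.snd_sub] <;> field_simp <;> ring
  have hA1 : A.1 = X.1 + α * (E.1 - B.1) := by simpa using congrArg Prod.fst hAX
  have hA2 : A.2 = X.2 + α * (E.2 - B.2) := by simpa using congrArg Prod.snd hAX
  have hY1 : Y.1 = A.1 + β * (E.1 - B.1) := by simpa using congrArg Prod.fst hAY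
  have hY2 : Y.2 = A.2 + β * (E.2 - B.2) := by simpa using congrArg Prod.snd hAY
  have hA_mem : A ∈ segment ℝ X Y := by
    refine ⟨β / (α + β), α / (α + β), by positivity, by positivity, by field_simp; ring, ?_⟩
    ext <;> simp only [Prod.fst_add, Prod.snd_add, Prod.smul_fst, Prod.smul_snd,
      smul_eq_mul, hY1, hY2, hA1, hA2] <;> field_simp <;> ring
  have hbcY : cross B C Y = (α + β) * cross B C E := by
    have : cross B C X = 0 := by rw [cross_X]; simp only [cross]; ring
    simp only [cross] at this ⊢
    rw [hY1, hY2, hA1, hA2]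
    linear_combination this
  have hdeX : cross D E X = (α + β) * cross B D E := by
    have : cross D E Y = 0 := by rw [cross_Y]; simp only [cross]; ring
    simp only [cross] at this ⊢
    rw [hY1, hY2, hA1, hA2] at this
    linear_combination this
  have hinside : convexHull ℝ {A, B, C, D, E} ⊆ convexHull ℝ {X, Y, C, D} := by
    refine convexHull_min ?_ (convex_convexHull ℝ _)
    simp only [Set.insert_subset_iff, Set.singleton_subset_iff]
    refine ⟨segment_subset_convexHull ?_ ?_ hA_mem, segment_subset_convexHull ?_ ?_ hB_mem,
      subset_convexHull ℝ _ ?_, subset_convexHull ℝ _ ?_,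
      segment_subset_convexHull ?_ ?_ hE_mem⟩ <;> simp
  have hAXB : cross A X B = cross A B E * α := by
    simp only [cross]
    linear_combination (A.2 - B.2) * hA1 - (A.1 - B.1) * hA2
  have hAEY : cross A E Y = cross A B E * β := by
    simp only [cross]
    rw [hY1, hY2]
    ring
  have hcover : convexHull ℝ {X, Y, C, D} ⊆
      convexHull ℝ {A, B, C, D, E} ∪ convexHull ℝ {A, X, B} ∪ convexHull ℝ {A, E, Y} := by
    intro z hz
    have hBCz : 0 ≤ cross B C z := by
      refine le_cross_of_mem_convexHull ?_ hz
      simp only [Set.mem_insert_iff, Set.mem_singleton_iff, forall_eq_or_imp, forall_eq]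
      refine ⟨?_, ?_, ?_, hbcd.le⟩
      · rw [cross_X]; simp only [cross]; linarith
      · rw [hbcY]; positivity
      · simp only [cross]; linarith
    have hCDz : 0 ≤ cross C D z := by
      refine le_cross_of_mem_convexHull ?_ hz
      simp only [Set.mem_insert_iff, Set.mem_singleton_iff, forall_eq_or_imp, forall_eq]
      refine ⟨?_, ?_, ?_, ?_⟩
      · have : cross C D X = (1 + s) * cross B C D := by rw [cross_X]; simp only [cross]; ring
        rw [this]; positivity
      · have : cross C D Y = (1 + r) * cross C D E := by rw [cross_Y]; simp only [cross]; ring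
        rw [this]; positivity
      · simp only [cross]; linarith
      · simp only [cross]; linarith
    have hDEz : 0 ≤ cross D E z := by
      refine le_cross_of_mem_convexHull ?_ hz
      simp only [Set.mem_insert_iff, Set.mem_singleton_iff, forall_eq_or_imp, forall_eq]
      refine ⟨?_, ?_, ?_, ?_⟩
      · rw [hdeX]; positivity
      · rw [cross_Y]; simp only [cross]; linarith
      · rw [cross_rotate]; exact hcde.le
      · simp only [cross]; linarith
    have hEBz : -cross A B E ≤ cross E B z := by
      refine le_cross_of_mem_convexHull ?_ hz
      simp only [Set.mem_insert_iff, Set.mem_singleton_iff, forall_eq_or_imp, forall_eq]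
      have hEBX : cross E B X = -cross A B E := by
        simp only [cross]
        linear_combination (B.2 - E.2) * hA1 - (B.1 - E.1) * hA2
      have hEBY : cross E B Y = -cross A B E := by
        simp only [cross]
        rw [hY1, hY2]
        ring
      refine ⟨hEBX.ge, hEBY.ge, ?_, ?_⟩
      · have : cross E B C = cross B C E := (cross_rotate E B C).symm
        linarith
      · have : cross E B D = cross B D E := (cross_rotate E B D).symm
        linarith
    rcases le_total 0 (cross A B z) with hABz | hABz
    · rcases le_total 0 (cross E A z) with hEAz | hEAz
      · exact .inl (.inl (mem_pentagon_of_cross_nonneg h hABz hBCz hCDz hDEz hEAz))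
      · refine .inr (mem_triangle_of_cross_nonneg (hAEY ▸ by positivity) ?_ ?_ ?_)
        · rw [cross_swap]; linarith
        · have : cross E Y z = r * cross D E z := by
            simp only [hY, cross, Prod.fst_add, Prod.snd_add, Prod.smul_fst, Prod.smul_snd,
              smul_eq_mul, Prod.fst_sub, Prod.snd_sub]
            ring
          rw [this]; positivity
        · have : cross Y A z = β * (cross E B z + cross A B E) := by
            simp only [cross]
            rw [hY1, hY2]
            ring
          rw [this]
          exact mul_nonneg hβ0.le (by linarith)
    · refine .inl (.inr (mem_triangle_of_cross_nonneg (hAXB ▸ by positivity) ?_ ?_ ?_))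
      · have : cross A X z = α * (cross E B z + cross A B E) := by
          simp only [cross]
          linear_combination (A.2 - z.2) * hA1 - (A.1 - z.1) * hA2
        rw [this]
        exact mul_nonneg hα0.le (by linarith)
      · have : cross X B z = s * cross B C z := by
          simp only [hX, cross, Prod.fst_add, Prod.snd_add, Prod.smul_fst, Prod.smul_snd,
            smul_eq_mul, Prod.fst_sub, Prod.snd_sub]
          ring
        rw [this]; positivity
      · rw [cross_swap]; linarith
  refine ⟨X, Y, hinside, ?_⟩
  set c := volume (convexHull ℝ {((0 : ℝ), (0 : ℝ)), ((1 : ℝ), (0 : ℝ)), ((0 : ℝ), (1 : ℝ))})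
  set V := volume (convexHull ℝ {A, B, C, D, E})
  have hV := volume_pentagon_ge h
  have hbound := area_ratio_bound (t := cross A B E) (p := cross A B C) (q := cross A D E)
    (x := cross B D E) (y := cross B C E)
    (m := cross A B C + cross A C D + cross A D E - cross A B E) habe hB hE hbde hbce
    (by simp only [cross] at *; linarith) (by simp only [cross] at *; linarith)
    (by simp only [cross]; ring)
  have h5 : 1 ≤ 3 / √5 := by
    rw [one_le_div (by positivity)]
    exact Real.sqrt_le_iff.2 (by norm_num)
  calc volume (convexHull ℝ {X, Y, C, D})
      ≤ V + volume (convexHull ℝ {A, X, B}) + volume (convexHull ℝ {A, E, Y}) :=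
        (measure_mono hcover).trans ((measure_union_le _ _).trans
          (add_le_add_left (measure_union_le _ _) _))
    _ = V + ENNReal.ofReal (cross A B E * α + cross A B E * β) * c := by
        rw [volume_triangle (A := A) (B := X) (C := B) (hAXB ▸ by positivity),
          volume_triangle (A := A) (B := E) (C := Y) (hAEY ▸ by positivity), hAXB, hAEY,
          ENNReal.ofReal_add (by positivity) (by positivity), add_mul, add_assoc]
    _ ≤ V + ENNReal.ofReal (3 / √5 - 1) * V := by
        refine add_le_add_right (le_trans ?_ (mul_le_mul_right hV _)) _
        rw [← mul_assoc, ← ENNReal.ofReal_mul (by linarith)]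
        gcongr
        linarith
    _ = ENNReal.ofReal (3 / √5) * V := by
        nth_rw 1 [← one_mul V]
        rw [← add_mul, ← ENNReal.ofReal_one, ← ENNReal.ofReal_add one_pos.le (by linarith),
          add_sub_cancel]

lemma IsCcwPentagon.exists_quadrilateral {A B C D E : ℝ × ℝ} (h : IsCcwPentagon A B C D E) :
    ∃ X Y Z W : ℝ × ℝ, convexHull ℝ {A, B, C, D, E} ⊆ convexHull ℝ {X, Y, Z, W} ∧
      volume (convexHull ℝ {X, Y, Z, W}) ≤
        ENNReal.ofReal (3 / √5) * volume (convexHull ℝ {A, B, C, D, E}) := by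
  have main {A B C D E : ℝ × ℝ} {s : Set (ℝ × ℝ)} (hs : s = {A, B, C, D, E})
      (h : IsCcwPentagon A B C D E)
      (hB : cross A B E ≤ cross A B C) (hC : cross A B E ≤ cross B C D)
      (hD : cross A B E ≤ cross C D E) (hE : cross A B E ≤ cross D E A) :
      ∃ X Y Z W : ℝ × ℝ, convexHull ℝ s ⊆ convexHull ℝ {X, Y, Z, W} ∧
        volume (convexHull ℝ {X, Y, Z, W}) ≤ ENNReal.ofReal (3 / √5) * volume (convexHull ℝ s) := by
    rw [cross_rotate A D E] at hE
    obtain ⟨X, Y, hXY⟩ := h.exists_quadrilateral_of_min_ear hB hC hD hE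
    exact ⟨X, Y, C, D, hs ▸ hXY⟩
  let ear : Fin 5 → ℝ := ![cross A B E, cross A B C, cross B C D, cross C D E, cross D E A]
  obtain ⟨i, hi⟩ := Finite.exists_min ear
  have h0 := hi 0
  have h1 := hi 1
  have h2 := hi 2
  have h3 := hi 3
  have h4 := hi 4
  fin_cases i <;> simp [ear] at h0 h1 h2 h3 h4
  · exact main rfl h h1 h2 h3 h4
  · refine main ?_ h.rotate ?_ ?_ ?_ ?_
    · ext; simp; tauto
    all_goals simp only [cross] at *; linarith
  · refine main ?_ h.rotate.rotate ?_ ?_ ?_ ?_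
    · ext; simp; tauto
    all_goals simp only [cross] at *; linarith
  · refine main ?_ h.rotate.rotate.rotate ?_ ?_ ?_ ?_
    · ext; simp; tauto
    all_goals simp only [cross] at *; linarith
  · refine main ?_ h.rotate.rotate.rotate.rotate ?_ ?_ ?_ ?_
    · ext; simp; tauto
    all_goals simp only [cross] at *; linarith

/-- Every convex pentagon `P` is contained in a convex quadrilateral `Q`
with `|Q| ≤ (3/√5)·|P|`. -/
theorem pentagon_in_small_quadrilateral (P : Set (ℝ × ℝ)) (hP : IsConvexPolygon 5 P) :
    ∃ Q : Set (ℝ × ℝ), IsConvexPolygon 4 Q ∧ P ⊆ Q ∧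
      volume Q ≤ ENNReal.ofReal (3 / Real.sqrt 5) * volume P := by
  obtain ⟨S, hcard, rfl, hint⟩ := hP
  have h5 : 1 ≤ 3 / √5 := by
    rw [one_le_div (by positivity)]
    exact Real.sqrt_le_iff.2 (by norm_num)
  have self_bound (V : ENNReal) : V ≤ ENNReal.ofReal (3 / √5) * V :=
    le_mul_of_one_le_left' (by simpa using h5)
  rcases hcard.lt_or_eq with hlt | hcard
  · exact ⟨_, ⟨S, by omega, rfl, hint⟩, subset_rfl, self_bound _⟩
  by_cases hS : ∀ p ∈ S, p ∉ convexHull ℝ (S.erase p : Set (ℝ × ℝ))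
  · obtain ⟨A, B, C, D, E, hSeq, h⟩ := exists_isCcwPentagon hcard hS
    rw [hSeq] at hint ⊢
    obtain ⟨X, Y, Z, W, hsub, hvol⟩ := h.exists_quadrilateral
    refine ⟨_, ⟨{X, Y, Z, W}, Finset.card_le_four, rfl, ?_⟩, ?_, ?_⟩
    · exact hint.mono (interior_mono (by simpa using hsub))
    · simpa using hsub
    · simpa using hvol
  · push Not at hS
    obtain ⟨p, hp, hmem⟩ := hS
    have hhull : convexHull ℝ (S : Set (ℝ × ℝ)) = convexHull ℝ (S.erase p : Set (ℝ × ℝ)) := by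
      refine (convexHull_min (fun w hw => ?_) (convex_convexHull ℝ _)).antisymm
        (convexHull_mono (by simp))
      rcases eq_or_ne w p with rfl | hne
      · exact hmem
      · exact subset_convexHull ℝ _ (by simpa using ⟨hw, hne⟩)
    exact ⟨_, ⟨S.erase p, by rw [Finset.card_erase_of_mem hp, hcard], hhull, hint⟩, subset_rfl,
      self_bound _⟩
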